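/- (Corollary 1.) Let M be an MDP with rewards bounded in [−Rmax, Rmax] and discount γ ∈ [0,1), let M̂_p be the (α, Rmax)-pessimistic MDP built from an approximate kernel P̂, its α-unknown set U, and estimated initial distribution ρ̂0. Let π* be an optimal policy for M, and suppose π_out is ε_π-suboptimal for M̂_p, i.e., J_{ρ̂0}(π, M̂_p) ≤ J_{ρ̂0}(π_out, M̂_p) + ε_π for all policies π. Then: J_{ρ0}(π*, M) − J_{ρ0}(π_out, M) ≤ ε_π + (4·Rmax/(1−γ))·D_TV(ρ0, ρ̂0) + (4·γ·Rmax/(1−γ)²)·α + (2·Rmax/(1−γ))·E[γ^{T_U^{π*}}]. -/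

import Mathlib

open scoped ENNReal NNReal
open Classical

namespace MOReL

universe u v

variable {S : Type u} {A : Type v}

/-- Distribution over trajectory prefixes `(s_0,a_0),…,(s_n,a_n)` generated by executing
policy `π` in the MDP with transition kernel `P` starting from `ρ0`. -/
noncomputable def pathPMF (ρ0 : PMF S) (π : S → PMF A) (P : S → A → PMF S) :
    (n : ℕ) → PMF (Fin (n + 1) → S × A)
  | 0 => ρ0.bind fun s => (π s).map fun a => fun _ => (s, a)
  | n + 1 =>
      (pathPMF ρ0 π P n).bind fun p =>
        (P (p (Fin.last n)).1 (p (Fin.last n)).2).bind fun s' =>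
          (π s').map fun a' => Fin.snoc p (s', a')

/-- Marginal distribution of `(s_t, a_t)`. -/
noncomputable def saDist (ρ0 : PMF S) (π : S → PMF A) (P : S → A → PMF S) (t : ℕ) :
    PMF (S × A) :=
  (pathPMF ρ0 π P t).map fun p => p (Fin.last t)

/-- Expectation of a real-valued function under a PMF. -/
noncomputable def pexp {α : Type*} (μ : PMF α) (f : α → ℝ) : ℝ :=
  ∑' x, (μ x).toReal * f x

/-- The value `J_{ρ0}(π, M) = E[∑_t γ^t r(s_t,a_t)]`. -/
noncomputable def J (ρ0 : PMF S) (π : S → PMF A) (P : S → A → PMF S) (γ : ℝ)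
    (r : S → A → ℝ) : ℝ :=
  ∑' t : ℕ, γ ^ t * pexp (saDist ρ0 π P t) (fun sa => r sa.1 sa.2)

/-- `P(T_V^π = t)`: the probability that the first visit of the executed trajectory to the
state-action set `V` occurs at time `t`. -/
noncomputable def hitProb (ρ0 : PMF S) (π : S → PMF A) (P : S → A → PMF S)
    (V : Set (S × A)) (t : ℕ) : ℝ≥0∞ :=
  (pathPMF ρ0 π P t).toOuterMeasure
    {p | p (Fin.last t) ∈ V ∧ ∀ i : Fin (t + 1), (i : ℕ) < t → p i ∉ V}

/-- `E[γ^{T_V^π}]`, with the convention `γ^∞ = 0`. -/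
noncomputable def discHit (ρ0 : PMF S) (π : S → PMF A) (P : S → A → PMF S) (γ : ℝ)
    (V : Set (S × A)) : ℝ :=
  ∑' t : ℕ, γ ^ t * (hitProb ρ0 π P V t).toReal

/-- Total variation distance between two PMFs. -/
noncomputable def DTV {α : Type*} (p q : PMF α) : ℝ :=
  (1 / 2) * ∑' x, |(p x).toReal - (q x).toReal|

/-- Discounted state-action visitation distribution `d^{π,M}(s,a)`. -/
noncomputable def dVisit (ρ0 : PMF S) (π : S → PMF A) (P : S → A → PMF S) (γ : ℝ)
    (sa : S × A) : ℝ :=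
  (1 - γ) * ∑' t : ℕ, γ ^ t * ((saDist ρ0 π P t) sa).toReal

/-- `d^{π,M}(V)` for a set `V` of state-action pairs. -/
noncomputable def dVisitSet (ρ0 : PMF S) (π : S → PMF A) (P : S → A → PMF S) (γ : ℝ)
    (V : Set (S × A)) : ℝ :=
  ∑' sa : V, dVisit ρ0 π P γ sa

/-- The set of `α`-unknown state-action pairs. -/
def unknown (P Phat : S → A → PMF S) (α : ℝ) : Set (S × A) :=
  {sa | α < DTV (Phat sa.1 sa.2) (P sa.1 sa.2)}

/-- Transition kernel of the pessimistic MDP on `Option S` (`none` is the absorbing state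
HALT): unknown pairs and HALT transition to HALT, known pairs follow `Phat`. -/
noncomputable def pessKernel (Phat : S → A → PMF S) (U : Set (S × A)) :
    Option S → A → PMF (Option S) := fun s a =>
  match s with
  | none => PMF.pure none
  | some s => if (s, a) ∈ U then PMF.pure none else (Phat s a).map some

/-- Reward of the pessimistic MDP: `-κ` at HALT and `r` elsewhere. -/
def pessReward (r : S → A → ℝ) (κ : ℝ) : Option S → A → ℝ := fun s a =>
  match s with
  | none => -κ
  | some s => r s a

/-- Extend a policy on `S` to `Option S` by an arbitrary action distribution at HALT
(the pessimistic value does not depend on this choice). -/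
def extendPolicy (π : S → PMF A) (a0 : PMF A) : Option S → PMF A := fun s =>
  match s with
  | none => a0
  | some s => π s

end MOReL

namespace MOReL

section Expectation

variable {X : Type*} {Y : Type*}

lemma summable_toReal (μ : PMF X) : Summable fun x => (μ x).toReal :=
  ENNReal.summable_toReal μ.tsum_coe_ne_top

lemma tsum_toReal (μ : PMF X) : ∑' x, (μ x).toReal = 1 := by
  rw [← ENNReal.tsum_toReal_eq fun x => μ.apply_ne_top x, μ.tsum_coe, ENNReal.toReal_one]

lemma summable_pexp (μ : PMF X) {f : X → ℝ} {B : ℝ} (hf : ∀ x, |f x| ≤ B) :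
    Summable fun x => (μ x).toReal * f x := by
  refine Summable.of_norm_bounded ((summable_toReal μ).mul_right B) fun x => ?_
  rw [Real.norm_eq_abs, abs_mul, abs_of_nonneg ENNReal.toReal_nonneg]
  exact mul_le_mul_of_nonneg_left (hf x) ENNReal.toReal_nonneg

lemma pexp_const (μ : PMF X) (c : ℝ) : pexp μ (fun _ => c) = c := by
  rw [pexp, tsum_mul_right, tsum_toReal, one_mul]

lemma pexp_mono (μ : PMF X) {f g : X → ℝ} {B C : ℝ} (hf : ∀ x, |f x| ≤ B)
    (hg : ∀ x, |g x| ≤ C) (h : ∀ x, f x ≤ g x) : pexp μ f ≤ pexp μ g :=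
  (summable_pexp μ hf).tsum_le_tsum
    (fun x => mul_le_mul_of_nonneg_left (h x) ENNReal.toReal_nonneg) (summable_pexp μ hg)

lemma pexp_add (μ : PMF X) {f g : X → ℝ} {B C : ℝ} (hf : ∀ x, |f x| ≤ B)
    (hg : ∀ x, |g x| ≤ C) : pexp μ (fun x => f x + g x) = pexp μ f + pexp μ g := by
  simp only [pexp, mul_add]
  exact (summable_pexp μ hf).tsum_add (summable_pexp μ hg)

lemma pexp_sub (μ : PMF X) {f g : X → ℝ} {B C : ℝ} (hf : ∀ x, |f x| ≤ B)
    (hg : ∀ x, |g x| ≤ C) : pexp μ (fun x => f x - g x) = pexp μ f - pexp μ g := by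
  simp only [pexp, mul_sub]
  exact (summable_pexp μ hf).tsum_sub (summable_pexp μ hg)

lemma pexp_const_mul (μ : PMF X) (c : ℝ) (f : X → ℝ) :
    pexp μ (fun x => c * f x) = c * pexp μ f := by
  simp only [pexp, mul_left_comm _ c, tsum_mul_left]

lemma abs_pexp_le (μ : PMF X) {f : X → ℝ} {B : ℝ} (hf : ∀ x, |f x| ≤ B) :
    |pexp μ f| ≤ B := by
  have hB : ∀ c : ℝ, ∀ _ : X, |c| ≤ |c| := fun c _ => le_rfl
  rw [abs_le]
  constructor
  · simpa only [pexp_const] using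
      pexp_mono μ (hB (-B)) hf fun x => (abs_le.1 (hf x)).1
  · simpa only [pexp_const] using pexp_mono μ hf (hB B) fun x => (abs_le.1 (hf x)).2

lemma pexp_pure (x : X) (f : X → ℝ) : pexp (PMF.pure x) f = f x := by
  rw [pexp, tsum_eq_single x]
  · simp
  · intro y hy
    simp [PMF.pure_apply, hy]

/-- Expectations commute with absolutely convergent weighted sums of uniformly bounded functions. -/
lemma pexp_tsum (μ : PMF X) {w : Y → ℝ} (hw0 : ∀ y, 0 ≤ w y) (hw : Summable w)
    {g : Y → X → ℝ} {B : ℝ} (hg : ∀ y x, |g y x| ≤ B) :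
    pexp μ (fun x => ∑' y, w y * g y x) = ∑' y, w y * pexp μ (g y) := by
  simp only [pexp, ← tsum_mul_left]
  have hs : Summable fun q : X × Y => (μ q.1).toReal * (w q.2 * g q.2 q.1) := by
    refine Summable.of_norm_bounded
      (((summable_toReal μ).mul_of_nonneg hw (fun _ => ENNReal.toReal_nonneg) hw0).mul_right B)
      fun q => ?_
    rw [Real.norm_eq_abs, abs_mul, abs_mul, abs_of_nonneg ENNReal.toReal_nonneg,
      abs_of_nonneg (hw0 _), mul_assoc]
    exact mul_le_mul_of_nonneg_left (mul_le_mul_of_nonneg_left (hg _ _) (hw0 _))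
      ENNReal.toReal_nonneg
  rw [← Summable.tsum_comm (f := fun x y => (μ x).toReal * (w y * g y x)) hs]
  simp only [mul_left_comm]

lemma pexp_bind (μ : PMF X) (κ : X → PMF Y) {f : Y → ℝ} {B : ℝ} (hf : ∀ y, |f y| ≤ B) :
    pexp (μ.bind κ) f = pexp μ fun x => pexp (κ x) f := by
  have hs : Summable fun q : X × Y => (μ q.1).toReal * ((κ q.1 q.2).toReal * f q.2) := by
    have h1 : Summable fun q : X × Y => (μ q.1).toReal * (κ q.1 q.2).toReal := by
      have h0 : ∀ q : X × Y, 0 ≤ (μ q.1).toReal * (κ q.1 q.2).toReal := fun _ =>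
        mul_nonneg ENNReal.toReal_nonneg ENNReal.toReal_nonneg
      refine (summable_prod_of_nonneg h0).2 ⟨fun x => (summable_toReal (κ x)).mul_left (μ x).toReal, ?_⟩
      simp only [tsum_mul_left, tsum_toReal, mul_one]
      exact summable_toReal μ
    refine Summable.of_norm_bounded (h1.mul_right B) fun q => ?_
    rw [Real.norm_eq_abs, abs_mul, abs_mul, abs_of_nonneg ENNReal.toReal_nonneg,
      abs_of_nonneg ENNReal.toReal_nonneg, mul_assoc]
    exact mul_le_mul_of_nonneg_left
      (mul_le_mul_of_nonneg_left (hf _) ENNReal.toReal_nonneg) ENNReal.toReal_nonneg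
  have hb : ∀ y, (μ.bind κ y).toReal = ∑' x, (μ x).toReal * (κ x y).toReal := fun y => by
    rw [PMF.bind_apply, ENNReal.tsum_toReal_eq fun x =>
      ENNReal.mul_ne_top (μ.apply_ne_top x) ((κ x).apply_ne_top y)]
    simp only [ENNReal.toReal_mul]
  simp only [pexp, hb, ← tsum_mul_left, ← tsum_mul_right, mul_assoc]
  exact Summable.tsum_comm (f := fun x y => (μ x).toReal * ((κ x y).toReal * f y)) hs

lemma pexp_map (μ : PMF X) (g : X → Y) {f : Y → ℝ} {B : ℝ} (hf : ∀ y, |f y| ≤ B) :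
    pexp (μ.map g) f = pexp μ fun x => f (g x) := by
  rw [PMF.map, pexp_bind μ _ hf]
  simp only [Function.comp, pexp_pure]

lemma toOuterMeasure_toReal (μ : PMF X) (q : X → Prop) [DecidablePred q] :
    (μ.toOuterMeasure {x | q x}).toReal = pexp μ fun x => if q x then 1 else 0 := by
  rw [PMF.toOuterMeasure_apply, ENNReal.tsum_toReal_eq, pexp]
  · refine tsum_congr fun x => ?_
    by_cases hx : q x <;> simp [hx]
  · intro x
    by_cases hx : q x <;> simp [hx, μ.apply_ne_top x]

lemma abs_pexp_sub_pexp_le (μ ν : PMF X) {f : X → ℝ} {B : ℝ} (hf : ∀ x, |f x| ≤ B) :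
    |pexp μ f - pexp ν f| ≤ 2 * B * DTV μ ν := by
  have hs : Summable fun x => |(μ x).toReal - (ν x).toReal| :=
    ((summable_toReal μ).sub (summable_toReal ν)).abs
  have h : pexp μ f - pexp ν f = ∑' x, ((μ x).toReal - (ν x).toReal) * f x := by
    rw [pexp, pexp, ← (summable_pexp μ hf).tsum_sub (summable_pexp ν hf)]
    simp only [sub_mul]
  have hle : ‖∑' x, ((μ x).toReal - (ν x).toReal) * f x‖
      ≤ ∑' x, |(μ x).toReal - (ν x).toReal| * B := by
    refine tsum_of_norm_bounded (hs.mul_right B).hasSum fun x => ?_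
    rw [Real.norm_eq_abs, abs_mul]
    exact mul_le_mul_of_nonneg_left (hf x) (abs_nonneg _)
  rw [tsum_mul_right, Real.norm_eq_abs, ← h] at hle
  rw [DTV]
  linarith

end Expectation

section Chain

variable (ρ0 : PMF S) (π : S → PMF A) (P : S → A → PMF S)

/-- Average of a state-action function over the actions drawn from a policy. -/
noncomputable def actAvg (f : S × A → ℝ) (s : S) : ℝ :=
  pexp (π s) fun a => f (s, a)

/-- One-step transition operator on state-action functions. -/
noncomputable def stepOp (f : S × A → ℝ) (z : S × A) : ℝ :=
  pexp (P z.1 z.2) (actAvg π f)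

/-- State-action value function. -/
noncomputable def qValue (γ : ℝ) (r : S → A → ℝ) (z : S × A) : ℝ :=
  ∑' t : ℕ, γ ^ t * ((stepOp π P)^[t] fun sa => r sa.1 sa.2) z

variable {f g : S × A → ℝ} {B C : ℝ}

lemma abs_actAvg_le (hf : ∀ z, |f z| ≤ B) (s : S) : |actAvg π f s| ≤ B :=
  abs_pexp_le _ fun _ => hf _

lemma abs_stepOp_le (hf : ∀ z, |f z| ≤ B) (z : S × A) : |stepOp π P f z| ≤ B :=
  abs_pexp_le _ (abs_actAvg_le π hf)

lemma abs_stepOp_iterate_le (hf : ∀ z, |f z| ≤ B) (t : ℕ) (z : S × A) :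
    |(stepOp π P)^[t] f z| ≤ B := by
  induction t generalizing z with
  | zero => exact hf z
  | succ t ih =>
    rw [Function.iterate_succ_apply']
    exact abs_stepOp_le π P ih z

lemma stepOp_const (c : ℝ) (z : S × A) : stepOp π P (fun _ => c) z = c := by
  unfold stepOp actAvg
  simp only [pexp_const]

lemma actAvg_sub (hf : ∀ z, |f z| ≤ B) (hg : ∀ z, |g z| ≤ C) (s : S) :
    actAvg π (fun z => f z - g z) s = actAvg π f s - actAvg π g s :=
  pexp_sub _ (fun _ => hf _) fun _ => hg _

lemma stepOp_sub (hf : ∀ z, |f z| ≤ B) (hg : ∀ z, |g z| ≤ C) (z : S × A) :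
    stepOp π P (fun z => f z - g z) z = stepOp π P f z - stepOp π P g z := by
  simp only [stepOp]
  rw [← pexp_sub _ (abs_actAvg_le π hf) (abs_actAvg_le π hg)]
  congr 1
  funext s
  exact actAvg_sub π hf hg s

lemma pexp_pathPMF_zero {G : (Fin 1 → S × A) → ℝ} (hG : ∀ p, |G p| ≤ B) :
    pexp (pathPMF ρ0 π P 0) G = pexp ρ0 (actAvg π fun z => G fun _ => z) := by
  rw [pathPMF, pexp_bind _ _ hG]
  congr 1
  funext s
  exact pexp_map _ _ hG

lemma pexp_pathPMF_succ (t : ℕ) {G : (Fin (t + 2) → S × A) → ℝ} (hG : ∀ p, |G p| ≤ B) :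
    pexp (pathPMF ρ0 π P (t + 1)) G = pexp (pathPMF ρ0 π P t) fun p =>
      stepOp π P (fun z => G (Fin.snoc p z)) (p (Fin.last t)) := by
  rw [pathPMF, pexp_bind _ _ hG]
  congr 1
  funext p
  rw [pexp_bind _ _ hG]
  simp only [stepOp]
  congr 1
  funext s
  exact pexp_map _ _ hG

lemma pexp_saDist (t : ℕ) (hf : ∀ z, |f z| ≤ B) :
    pexp (saDist ρ0 π P t) f = pexp ρ0 (actAvg π ((stepOp π P)^[t] f)) := by
  induction t generalizing f with
  | zero =>
    rw [saDist, pexp_map _ _ hf, pexp_pathPMF_zero ρ0 π P fun _ => hf _]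
    rfl
  | succ t ih =>
    rw [Function.iterate_succ_apply, ← ih (abs_stepOp_le π P hf), saDist, saDist,
      pexp_map _ _ hf, pexp_map _ _ (abs_stepOp_le π P hf),
      pexp_pathPMF_succ ρ0 π P t fun _ => hf _]
    simp only [Fin.snoc_last]

variable {γ : ℝ} (hγ0 : 0 ≤ γ) (hγ1 : γ < 1) {r : S → A → ℝ} (hr : ∀ s a, |r s a| ≤ B)

include hγ0 hγ1 in
lemma actAvg_tsum {g : ℕ → S × A → ℝ} (hg : ∀ t z, |g t z| ≤ B) (s : S) :
    actAvg π (fun z => ∑' t : ℕ, γ ^ t * g t z) s = ∑' t : ℕ, γ ^ t * actAvg π (g t) s :=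
  pexp_tsum _ (fun _ => pow_nonneg hγ0 _) (summable_geometric_of_lt_one hγ0 hγ1) fun _ _ => hg _ _

include hγ0 hγ1 in
lemma pexp_actAvg_tsum {g : ℕ → S × A → ℝ} (hg : ∀ t z, |g t z| ≤ B) :
    pexp ρ0 (actAvg π (fun z => ∑' t : ℕ, γ ^ t * g t z))
      = ∑' t : ℕ, γ ^ t * pexp ρ0 (actAvg π (g t)) := by
  rw [← pexp_tsum ρ0 (fun _ => pow_nonneg hγ0 _) (summable_geometric_of_lt_one hγ0 hγ1)
    fun t => abs_actAvg_le π (hg t)]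
  congr 1
  funext s
  exact actAvg_tsum π hγ0 hγ1 hg s

include hγ0 hγ1 hr

lemma J_eq_pexp_qValue : J ρ0 π P γ r = pexp ρ0 (actAvg π (qValue π P γ r)) := by
  have hr' : ∀ z : S × A, |r z.1 z.2| ≤ B := fun z => hr _ _
  unfold qValue
  rw [pexp_actAvg_tsum ρ0 π hγ0 hγ1 (abs_stepOp_iterate_le π P hr'), J]
  simp only [pexp_saDist ρ0 π P _ hr']

lemma abs_qValue_le (z : S × A) : |qValue π P γ r z| ≤ B / (1 - γ) := by
  have h := (hasSum_geometric_of_lt_one hγ0 hγ1).mul_right B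
  rw [inv_mul_eq_div] at h
  refine tsum_of_norm_bounded (E := ℝ) h fun t => ?_
  rw [Real.norm_eq_abs, abs_mul, abs_of_nonneg (pow_nonneg hγ0 _)]
  exact mul_le_mul_of_nonneg_left
    (abs_stepOp_iterate_le π P (fun z : S × A => hr z.1 z.2) t z) (pow_nonneg hγ0 _)

lemma qValue_eq (z : S × A) :
    qValue π P γ r z = r z.1 z.2 + γ * stepOp π P (qValue π P γ r) z := by
  have hr' : ∀ z : S × A, |r z.1 z.2| ≤ B := fun z => hr _ _
  have hit := abs_stepOp_iterate_le π P hr'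
  have hs : Summable fun t : ℕ => γ ^ t * ((stepOp π P)^[t] fun sa => r sa.1 sa.2) z := by
    refine Summable.of_norm_bounded ((summable_geometric_of_lt_one hγ0 hγ1).mul_right B)
      fun t => ?_
    rw [Real.norm_eq_abs, abs_mul, abs_of_nonneg (pow_nonneg hγ0 _)]
    exact mul_le_mul_of_nonneg_left (hit t z) (pow_nonneg hγ0 _)
  have hK : stepOp π P (qValue π P γ r) z
      = ∑' t : ℕ, γ ^ t * ((stepOp π P)^[t + 1] fun sa => r sa.1 sa.2) z := by
    unfold qValue
    simp only [Function.iterate_succ_apply']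
    exact pexp_actAvg_tsum (P z.1 z.2) π hγ0 hγ1 hit
  rw [hK, qValue, hs.tsum_eq_zero_add, ← tsum_mul_left]
  simp only [pow_succ', pow_zero, one_mul, Function.iterate_zero, id, mul_assoc]

omit hr

/-- If `f ≤ c` on `U` and `f` is, up to an error `D`, discounted-subharmonic off `U`, then the
expectation of `f` at time zero is controlled by the discounted hitting time of `U`. -/
lemma pexp_actAvg_le_discHit (U : Set (S × A)) {c D : ℝ} (hc : 0 ≤ c) (hD : 0 ≤ D)
    (hf : ∀ z, |f z| ≤ B) (hU : ∀ z ∈ U, f z ≤ c)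
    (hUc : ∀ z ∉ U, f z ≤ D + γ * stepOp π P f z) :
    pexp ρ0 (actAvg π f) ≤ c * discHit ρ0 π P γ U + D / (1 - γ) := by
  set a : ℕ → ℝ := fun t => pexp (pathPMF ρ0 π P t) fun p =>
    if ∀ i : Fin (t + 1), (i : ℕ) < t → p i ∉ U then f (p (Fin.last t)) else 0 with ha
  set h : ℕ → ℝ := fun t => (hitProb ρ0 π P U t).toReal with hh
  obtain ⟨s, -⟩ := ρ0.support_nonempty
  obtain ⟨b, -⟩ := (π s).support_nonempty
  have hB : 0 ≤ B := (abs_nonneg _).trans (hf (s, b))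
  have hite : ∀ (q : Prop) [Decidable q] (x : ℝ), |x| ≤ B → |if q then x else 0| ≤ B :=
    fun q _ x hx => by
    split_ifs
    · exact hx
    · simpa using hB
  have hite1 : ∀ (q : Prop) [Decidable q], |if q then (1 : ℝ) else 0| ≤ 1 := fun q _ => by
    split_ifs <;> simp
  have ha0 : a 0 = pexp ρ0 (actAvg π f) := by
    simp only [ha]
    rw [pexp_pathPMF_zero ρ0 π P fun p => hite _ _ (hf _)]
    simp
  have haB : ∀ t, |a t| ≤ B := fun t => abs_pexp_le _ fun p => hite _ _ (hf _)
  have hh0 : ∀ t, 0 ≤ h t := fun t => ENNReal.toReal_nonneg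
  have hhe : ∀ t, h t = pexp (pathPMF ρ0 π P t) fun p =>
      if p (Fin.last t) ∈ U ∧ ∀ i : Fin (t + 1), (i : ℕ) < t → p i ∉ U then 1 else 0 := fun t =>
    toOuterMeasure_toReal _ _
  have hh1 : ∀ t, h t ≤ 1 := fun t => by
    rw [hhe]
    exact (le_abs_self _).trans (abs_pexp_le _ fun p => hite1 _)
  have hasucc : ∀ t, a (t + 1) = pexp (pathPMF ρ0 π P t) fun p =>
      if ∀ i, p i ∉ U then stepOp π P f (p (Fin.last t)) else 0 := fun t => by
    simp only [ha]
    rw [pexp_pathPMF_succ ρ0 π P t fun p => hite _ _ (hf _)]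
    congr 1
    funext p
    have hiff : ∀ z, (∀ i : Fin (t + 1 + 1), (i : ℕ) < t + 1 →
        (Fin.snoc p z : Fin (t + 2) → S × A) i ∉ U) ↔ ∀ i, p i ∉ U := fun z => by
      rw [Fin.forall_fin_succ']
      simp [Fin.is_le]
    simp only [hiff, Fin.snoc_last]
    split_ifs
    · rfl
    · exact stepOp_const π P 0 _
  have hstep : ∀ t, a t ≤ (c * h t + D) + γ * a (t + 1) := fun t => by
    have hs := abs_stepOp_le π P hf
    rw [hhe, hasucc, ← pexp_const_mul, ← pexp_const_mul, ← pexp_const (pathPMF ρ0 π P t) D]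
    have b1 : ∀ p : Fin (t + 1) → S × A, |c * if p (Fin.last t) ∈ U ∧
        ∀ i : Fin (t + 1), (i : ℕ) < t → p i ∉ U then (1 : ℝ) else 0| ≤ c * 1 := fun p => by
      rw [abs_mul, abs_of_nonneg hc]
      exact mul_le_mul_of_nonneg_left (hite1 _) hc
    have b2 : ∀ p : Fin (t + 1) → S × A, |D| ≤ |D| := fun _ => le_rfl
    have b3 : ∀ p : Fin (t + 1) → S × A,
        |γ * if ∀ i, p i ∉ U then stepOp π P f (p (Fin.last t)) else 0| ≤ γ * B := fun p => by
      rw [abs_mul, abs_of_nonneg hγ0]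
      exact mul_le_mul_of_nonneg_left (hite _ _ (hs _)) hγ0
    have b12 := fun p => (abs_add_le _ _).trans (add_le_add (b1 p) (b2 p))
    rw [← pexp_add _ b1 b2, ← pexp_add _ b12 b3]
    refine pexp_mono _ (fun p => hite _ _ (hf _))
      (fun p => (abs_add_le _ _).trans (add_le_add (b12 p) (b3 p))) fun p => ?_
    by_cases hp : ∀ i : Fin (t + 1), (i : ℕ) < t → p i ∉ U
    · by_cases hl : p (Fin.last t) ∈ U
      · rw [if_pos hp, if_pos ⟨hl, hp⟩, if_neg fun h => h _ hl]
        linarith [hU _ hl]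
      · have hall : ∀ i, p i ∉ U := fun i => by
          rcases (Fin.is_le i).lt_or_eq with hi | hi
          · exact hp i hi
          · exact (Fin.ext hi : i = Fin.last t) ▸ hl
        rw [if_pos hp, if_neg fun h => hl h.1, if_pos hall]
        linarith [hUc _ hl]
    · rw [if_neg hp, if_neg fun h => hp h.2, if_neg fun h => hp fun i _ => h i]
      linarith
  have hpart : ∀ n, a 0 ≤ ∑ t ∈ Finset.range n, γ ^ t * (c * h t + D) + γ ^ n * a n := fun n => by
    induction n with
    | zero => simp
    | succ n ih =>
      rw [Finset.sum_range_succ, pow_succ]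
      nlinarith [mul_le_mul_of_nonneg_left (hstep n) (pow_nonneg hγ0 n)]
  have hgeo := summable_geometric_of_lt_one hγ0 hγ1
  have hsum : Summable fun t => γ ^ t * h t :=
    Summable.of_nonneg_of_le (fun t => mul_nonneg (pow_nonneg hγ0 _) (hh0 t))
      (fun t => mul_le_of_le_one_right (pow_nonneg hγ0 _) (hh1 t)) hgeo
  have hHas : HasSum (fun t => γ ^ t * (c * h t + D))
      (c * discHit ρ0 π P γ U + D / (1 - γ)) := by
    have h1 := (hsum.hasSum.mul_left c).add ((hasSum_geometric_of_lt_one hγ0 hγ1).mul_left D)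
    rw [← div_eq_mul_inv] at h1
    exact h1.congr_fun fun t => by ring
  rw [← ha0]
  have hlim : Filter.Tendsto (fun n => ∑ t ∈ Finset.range n, γ ^ t * (c * h t + D) + γ ^ n * B)
      Filter.atTop (nhds (c * discHit ρ0 π P γ U + D / (1 - γ) + 0 * B)) :=
    hHas.tendsto_sum_nat.add ((tendsto_pow_atTop_nhds_zero_of_lt_one hγ0 hγ1).mul_const B)
  rw [zero_mul, add_zero] at hlim
  refine ge_of_tendsto' hlim fun n => (hpart n).trans ?_
  gcongr
  exact (le_abs_self _).trans (haB n)

end Chain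

section Pessimistic

variable (Phat : S → A → PMF S) (U : Set (S × A)) (πe : Option S → PMF A)
  {r : S → A → ℝ} {R γ : ℝ}

lemma abs_pessReward_le (hR0 : 0 ≤ R) (hR : ∀ s a, |r s a| ≤ R) (s : Option S) (a : A) :
    |pessReward r R s a| ≤ R := by
  cases s with
  | none => simp [pessReward, abs_of_nonneg hR0]
  | some s => exact hR s a

lemma qValue_halt (hγ0 : 0 ≤ γ) (hγ1 : γ < 1) (a : A) :
    qValue πe (pessKernel Phat U) γ (pessReward r R) (none, a) = -(R / (1 - γ)) := by
  have hit : ∀ (t : ℕ) (a : A), ((stepOp πe (pessKernel Phat U))^[t]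
      fun sa => pessReward r R sa.1 sa.2) (none, a) = -R := fun t => by
    induction t with
    | zero => exact fun _ => rfl
    | succ t ih =>
      intro a
      rw [Function.iterate_succ_apply']
      simp only [stepOp, pessKernel, pexp_pure, actAvg, ih, pexp_const]
  simp only [qValue, hit, tsum_mul_right, tsum_geometric_of_lt_one hγ0 hγ1]
  ring

variable (hR0 : 0 ≤ R) (hR : ∀ s a, |r s a| ≤ R) (hγ0 : 0 ≤ γ) (hγ1 : γ < 1)

include hR0 hR hγ0 hγ1

lemma qValue_pess_of_mem {s : S} {a : A} (h : (s, a) ∈ U) :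
    qValue πe (pessKernel Phat U) γ (pessReward r R) (some s, a)
      = r s a - γ * (R / (1 - γ)) := by
  rw [qValue_eq πe _ hγ0 hγ1 (abs_pessReward_le hR0 hR)]
  simp only [stepOp, pessKernel, h, if_true, pexp_pure, actAvg,
    qValue_halt Phat U πe hγ0 hγ1, pexp_const, pessReward]
  ring

lemma qValue_pess_of_notMem {s : S} {a : A} (h : (s, a) ∉ U) :
    qValue πe (pessKernel Phat U) γ (pessReward r R) (some s, a)
      = r s a + γ * stepOp (fun s => πe (some s)) Phat
        (fun z => qValue πe (pessKernel Phat U) γ (pessReward r R) (some z.1, z.2)) (s, a) := by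
  have hq := abs_qValue_le πe (pessKernel Phat U) hγ0 hγ1 (abs_pessReward_le hR0 hR)
  rw [qValue_eq πe _ hγ0 hγ1 (abs_pessReward_le hR0 hR)]
  simp only [stepOp, pessKernel, h, if_false, pessReward]
  rw [pexp_map _ _ (abs_actAvg_le πe hq)]
  rfl

lemma J_pess (ρ : PMF S) :
    J (ρ.map some) πe (pessKernel Phat U) γ (pessReward r R)
      = pexp ρ (actAvg (fun s => πe (some s))
        fun z => qValue πe (pessKernel Phat U) γ (pessReward r R) (some z.1, z.2)) := by
  have hq := abs_qValue_le πe (pessKernel Phat U) hγ0 hγ1 (abs_pessReward_le hR0 hR)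
  rw [J_eq_pexp_qValue _ _ _ hγ0 hγ1 (abs_pessReward_le hR0 hR),
    pexp_map _ _ (abs_actAvg_le πe hq)]
  rfl

/-- The value of a policy in the true and in the pessimistic MDP differ by a bounded amount. -/
lemma J_sub_J_pess_le_and_le (P : S → A → PMF S) (ρ0 ρhat : PMF S) {α : ℝ} (hα : 0 ≤ α) :
    J ρ0 (fun s => πe (some s)) P γ r
        - J (ρhat.map some) πe (pessKernel Phat (unknown P Phat α)) γ (pessReward r R)
      ≤ 2 * (R / (1 - γ)) * DTV ρ0 ρhat + γ * (2 * (R / (1 - γ)) * α) / (1 - γ)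
        + 2 * (R / (1 - γ)) * discHit ρ0 (fun s => πe (some s)) P γ (unknown P Phat α) ∧
    J (ρhat.map some) πe (pessKernel Phat (unknown P Phat α)) γ (pessReward r R)
        - J ρ0 (fun s => πe (some s)) P γ r
      ≤ 2 * (R / (1 - γ)) * DTV ρ0 ρhat + γ * (2 * (R / (1 - γ)) * α) / (1 - γ) := by
  set U := unknown P Phat α with hUdef
  set π : S → PMF A := fun s => πe (some s) with hπ
  set q : S × A → ℝ := qValue π P γ r with hqdef
  set qp : S × A → ℝ :=
    fun z => qValue πe (pessKernel Phat U) γ (pessReward r R) (some z.1, z.2) with hqpdef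
  set V := R / (1 - γ) with hV
  have hV0 : 0 ≤ V := div_nonneg hR0 (by linarith)
  have hq : ∀ z, |q z| ≤ V := abs_qValue_le π P hγ0 hγ1 hR
  have hqp : ∀ z, |qp z| ≤ V := fun z =>
    abs_qValue_le πe (pessKernel Phat U) hγ0 hγ1 (abs_pessReward_le hR0 hR) _
  have hqe : ∀ z, q z = r z.1 z.2 + γ * stepOp π P q z := qValue_eq π P hγ0 hγ1 hR
  have hqpU : ∀ z ∈ U, qp z = r z.1 z.2 - γ * V := fun z hz =>
    qValue_pess_of_mem Phat U πe hR0 hR hγ0 hγ1 hz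
  have hqpUc : ∀ z ∉ U, qp z = r z.1 z.2 + γ * stepOp π Phat qp z := fun z hz =>
    qValue_pess_of_notMem Phat U πe hR0 hR hγ0 hγ1 hz
  have htv : ∀ z ∉ U, |stepOp π Phat qp z - stepOp π P qp z| ≤ 2 * V * α := fun z hz =>
    (abs_pexp_sub_pexp_le _ _ (abs_actAvg_le π hqp)).trans
      (mul_le_mul_of_nonneg_left (not_lt.1 hz) (by positivity))
  have hD : 0 ≤ γ * (2 * V * α) := by positivity
  have hstart := abs_le.1 (abs_pexp_sub_pexp_le ρ0 ρhat (abs_actAvg_le π hqp))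
  have hdiff : ∀ {f g : S × A → ℝ}, (∀ z, |f z| ≤ V) → (∀ z, |g z| ≤ V) →
      pexp ρ0 (actAvg π fun z => f z - g z) = pexp ρ0 (actAvg π f) - pexp ρ0 (actAvg π g) :=
    fun hf hg => by
      rw [← pexp_sub ρ0 (abs_actAvg_le π hf) (abs_actAvg_le π hg)]
      congr 1
      funext s
      exact actAvg_sub π hf hg s
  rw [J_pess Phat U πe hR0 hR hγ0 hγ1 ρhat, J_eq_pexp_qValue ρ0 π P hγ0 hγ1 hR]
  constructor
  · have key := pexp_actAvg_le_discHit ρ0 π P hγ0 hγ1 U (f := fun z => q z - qp z)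
      (c := 2 * V) (D := γ * (2 * V * α)) (B := V + V) (by positivity) hD
      (fun z => (abs_sub _ _).trans (add_le_add (hq z) (hqp z)))
      (fun z _ => by linarith [(abs_le.1 (hq z)).2, (abs_le.1 (hqp z)).1])
      (fun z hz => by
        rw [stepOp_sub π P hq hqp, hqe, hqpUc z hz]
        nlinarith [mul_le_mul_of_nonneg_left (abs_le.1 (htv z hz)).1 hγ0])
    rw [hdiff hq hqp] at key
    linarith [hstart.2]
  · have key := pexp_actAvg_le_discHit ρ0 π P hγ0 hγ1 U (f := fun z => qp z - q z)
      (c := 0) (D := γ * (2 * V * α)) (B := V + V) le_rfl hD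
      (fun z => (abs_sub _ _).trans (add_le_add (hqp z) (hq z)))
      (fun z hz => by
        rw [hqpU z hz, hqe]
        nlinarith [mul_le_mul_of_nonneg_left (abs_le.1 (abs_stepOp_le π P hq z)).1 hγ0])
      (fun z hz => by
        rw [stepOp_sub π P hqp hq, hqe, hqpUc z hz]
        nlinarith [mul_le_mul_of_nonneg_left (abs_le.1 (htv z hz)).2 hγ0])
    rw [hdiff hqp hq] at key
    linarith [hstart.1]

end Pessimistic

/-- **Corollary 1.** If `πout` is `επ`-suboptimal in the `(α, Rmax)`-pessimistic MDP, then its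
suboptimality in the true MDP is controlled. -/
theorem morel_suboptimality
    {S : Type u} {A : Type v} [Countable S] [Countable A]
    (P Phat : S → A → PMF S) (ρ0 ρhat : PMF S)
    (r : S → A → ℝ) (Rmax : ℝ) (hR : ∀ s a, |r s a| ≤ Rmax)
    (γ : ℝ) (hγ0 : 0 ≤ γ) (hγ1 : γ < 1)
    (α : ℝ) (hα : 0 ≤ α)
    (πstar : S → PMF A)
    (hopt : ∀ π' : S → PMF A, J ρ0 π' P γ r ≤ J ρ0 πstar P γ r)
    (πout : Option S → PMF A) (επ : ℝ)
    (hsub : ∀ πe : Option S → PMF A,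
      J (ρhat.map some) πe (pessKernel Phat (unknown P Phat α)) γ (pessReward r Rmax)
        ≤ J (ρhat.map some) πout (pessKernel Phat (unknown P Phat α)) γ (pessReward r Rmax)
          + επ) :
    J ρ0 πstar P γ r - J ρ0 (fun s => πout (some s)) P γ r
      ≤ επ + (4 * Rmax / (1 - γ)) * DTV ρ0 ρhat
        + (4 * γ * Rmax / (1 - γ) ^ 2) * α
        + (2 * Rmax / (1 - γ)) * discHit ρ0 πstar P γ (unknown P Phat α) := by
  obtain ⟨s0, -⟩ := ρ0.support_nonempty
  obtain ⟨a0, -⟩ := (πstar s0).support_nonempty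
  have hR0 : 0 ≤ Rmax := (abs_nonneg _).trans (hR s0 a0)
  have hstar := (J_sub_J_pess_le_and_le Phat (extendPolicy πstar (PMF.pure a0))
    hR0 hR hγ0 hγ1 P ρ0 ρhat hα).1
  have hout := (J_sub_J_pess_le_and_le Phat πout hR0 hR hγ0 hγ1 P ρ0 ρhat hα).2
  have hle := hsub (extendPolicy πstar (PMF.pure a0))
  have hπ : (fun s => extendPolicy πstar (PMF.pure a0) (some s)) = πstar := rfl
  rw [hπ] at hstar
  have hγ : 1 - γ ≠ 0 := by linarith
  have e1 : 4 * Rmax / (1 - γ) = 2 * (2 * (Rmax / (1 - γ))) := by ring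
  have e2 : 4 * γ * Rmax / (1 - γ) ^ 2 * α
      = 2 * (γ * (2 * (Rmax / (1 - γ)) * α) / (1 - γ)) := by
    field_simp
    ring
  have e3 : 2 * Rmax / (1 - γ) = 2 * (Rmax / (1 - γ)) := by ring
  rw [e1, e2, e3]
  linarith

end MOReL
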